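/- arXiv:2510.12366 — 6 statements merged into one kernel-verified Lean document; each statement's English description precedes it below -/
import Mathlib

section
/- Let $N_I, N_R$ be positive integers. Let $Y_{II} \in \mathbb{C}^{N_I \times N_I}$ and $Y_{RR} \in \mathbb{C}^{N_R \times N_R}$ be complex symmetric matrices ($Y_{II} = Y_{II}^T$, $Y_{RR} = Y_{RR}^T$), and let $Y_{IR} \in \mathbb{C}^{N_I \times N_R}$. Assume the real block matrix $\begin{pmatrix} \mathrm{Re}(Y_{II}) & \mathrm{Re}(Y_{IR}) \\ \mathrm{Re}(Y_{IR})^T & \mathrm{Re}(Y_{RR}) \end{pmatrix}$ is symmetric positive definite. Let $Y_R \in \mathbb{R}^{N_R \times N_R}$ be a diagonal matrix with strictly positive diagonal entries. Then the complex matrix $Y_{RR} + Y_R$ is invertible, and the real symmetric matrix $\mathrm{Re}\big(Y_{II} - Y_{IR}(Y_{RR} + Y_R)^{-1} Y_{IR}^T\big)$ is positive definite. -/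
open Matrix Complex

namespace Matrix.IsSymm

variable {n : Type*} [Fintype n] {A : Matrix n n ℂ}

/-- The real part of the sesquilinear form of a complex symmetric matrix is given by the quadratic
form of the real part of the matrix. -/
theorem re_star_dotProduct_mulVec (hA : A.IsSymm) (w : n → ℂ) :
    (star w ⬝ᵥ A *ᵥ w).re =
      (fun i => (w i).re) ⬝ᵥ A.map Complex.re *ᵥ (fun i => (w i).re) +
      (fun i => (w i).im) ⬝ᵥ A.map Complex.re *ᵥ (fun i => (w i).im) := by
  have hcross : ∑ i, ∑ j, (w i).re * (A i j).im * (w j).im =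
      ∑ i, ∑ j, (w i).im * (A i j).im * (w j).re := by
    rw [Finset.sum_comm]
    refine Finset.sum_congr rfl fun i _ => Finset.sum_congr rfl fun j _ => ?_
    rw [hA.apply i j]
    ring
  simp only [dotProduct, mulVec, Finset.mul_sum, Complex.re_sum, map_apply]
  rw [← sub_eq_zero] at hcross ⊢
  rw [← neg_eq_zero, ← hcross]
  simp only [← Finset.sum_add_distrib, ← Finset.sum_sub_distrib, ← Finset.sum_neg_distrib]
  refine Finset.sum_congr rfl fun i _ => Finset.sum_congr rfl fun j _ => ?_
  simp only [Pi.star_apply, Complex.star_def, Complex.mul_re, Complex.mul_im, Complex.conj_re,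
    Complex.conj_im]
  ring

theorem re_star_dotProduct_mulVec_pos (hA : A.IsSymm) (hpos : (A.map Complex.re).PosDef)
    {w : n → ℂ} (hw : w ≠ 0) : 0 < (star w ⬝ᵥ A *ᵥ w).re := by
  rw [hA.re_star_dotProduct_mulVec]
  by_cases hre : (fun i => (w i).re) = 0
  · have him : (fun i => (w i).im) ≠ 0 := fun him =>
      hw (funext fun i => Complex.ext (congrFun hre i) (congrFun him i))
    exact add_pos_of_nonneg_of_pos (hpos.posSemidef.dotProduct_mulVec_nonneg _)
      (hpos.dotProduct_mulVec_pos him)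
  · exact add_pos_of_pos_of_nonneg (hpos.dotProduct_mulVec_pos hre)
      (hpos.posSemidef.dotProduct_mulVec_nonneg _)

theorem isUnit_of_posDef_map_re [DecidableEq n] (hA : A.IsSymm)
    (hpos : (A.map Complex.re).PosDef) : IsUnit A := by
  rw [← mulVec_injective_iff_isUnit]
  intro v w hvw
  by_contra hne
  have h := hA.re_star_dotProduct_mulVec_pos hpos (sub_ne_zero.mpr hne)
  rw [mulVec_sub, sub_eq_zero.mpr hvw] at h
  simp at h

/-- The real part of the Schur complement of a complex symmetric block matrix with positive definite
real part is positive definite. -/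
theorem posDef_map_re_schur {m : Type*} [Fintype m] [DecidableEq n] {D : Matrix m m ℂ}
    {B : Matrix m n ℂ} (hA : A.IsSymm) (hD : D.IsSymm)
    (hpos : ((Matrix.fromBlocks D B Bᵀ A).map Complex.re).PosDef) :
    ((D - B * A⁻¹ * Bᵀ).map Complex.re).PosDef := by
  have hApos : (A.map Complex.re).PosDef := hpos.submatrix (e := Sum.inr) Sum.inr_injective
  have hdet : IsUnit A.det := (isUnit_iff_isUnit_det A).mp (hA.isUnit_of_posDef_map_re hApos)
  have hM : (Matrix.fromBlocks D B Bᵀ A).IsSymm := IsSymm.fromBlocks hD rfl hA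
  have hS : (D - B * A⁻¹ * Bᵀ).IsSymm := by
    rw [IsSymm, transpose_sub, transpose_mul, transpose_mul, transpose_transpose,
      transpose_nonsing_inv, hA.eq, hD.eq, Matrix.mul_assoc]
  refine PosDef.of_dotProduct_mulVec_pos ?_ fun {x} hx => ?_
  · rw [IsHermitian, conjTranspose_eq_transpose_of_trivial, ← transpose_map, hS.eq]
  set y : m → ℂ := fun i => (x i : ℂ) with hy
  set w : m ⊕ n → ℂ := Sum.elim y (-(A⁻¹ *ᵥ (Bᵀ *ᵥ y))) with hw
  have hw0 : w ≠ 0 := fun h => hx (funext fun i => by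
    simpa [hw, hy] using congrFun h (Sum.inl i))
  have hMw : Matrix.fromBlocks D B Bᵀ A *ᵥ w = Sum.elim ((D - B * A⁻¹ * Bᵀ) *ᵥ y) 0 := by
    rw [hw, fromBlocks_mulVec]
    congr 1
    · rw [Sum.elim_comp_inl, Sum.elim_comp_inr, mulVec_neg, ← sub_eq_add_neg,
        mulVec_mulVec, mulVec_mulVec, sub_mulVec]
    · simp [mulVec_neg, mulVec_mulVec, ← Matrix.mul_assoc, mul_nonsing_inv A hdet]
  have hform : star w ⬝ᵥ Matrix.fromBlocks D B Bᵀ A *ᵥ w = star y ⬝ᵥ (D - B * A⁻¹ * Bᵀ) *ᵥ y := by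
    rw [hMw]
    simp [dotProduct, hw]
  have h := hM.re_star_dotProduct_mulVec_pos hpos hw0
  rw [hform, hS.re_star_dotProduct_mulVec] at h
  simpa [hy, dotProduct, mulVec] using h

end Matrix.IsSymm

/-- Lemma 1 of the paper: if the real part of the admittance block matrix is positive definite
and `Y_R` is a positive diagonal (load) matrix, then `Y_RR + Y_R` is invertible and
`Re(Y_II - Y_IR (Y_RR + Y_R)⁻¹ Y_IRᵀ)` is positive definite. -/
theorem stmt_0 {NI NR : ℕ} (hNI : 0 < NI) (hNR : 0 < NR)
    (YII : Matrix (Fin NI) (Fin NI) ℂ) (hYII : YII.IsSymm)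
    (YRR : Matrix (Fin NR) (Fin NR) ℂ) (hYRR : YRR.IsSymm)
    (YIR : Matrix (Fin NI) (Fin NR) ℂ)
    (hblk : (Matrix.fromBlocks (YII.map Complex.re) (YIR.map Complex.re)
      (YIR.map Complex.re)ᵀ (YRR.map Complex.re)).PosDef)
    (dR : Fin NR → ℝ) (hdR : ∀ i, 0 < dR i)
    (YR : Matrix (Fin NR) (Fin NR) ℝ) (hYR : YR = Matrix.diagonal dR) :
    IsUnit (YRR + YR.map Complex.ofReal) ∧
    ((YII - YIR * (YRR + YR.map Complex.ofReal)⁻¹ * YIRᵀ).map Complex.re).PosDef := by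
  have hS : (YRR + YR.map Complex.ofReal).IsSymm := by
    subst hYR
    refine hYRR.add ?_
    rw [IsSymm, ← transpose_map, diagonal_transpose]
  have hpos : ((fromBlocks YII YIR YIRᵀ (YRR + YR.map Complex.ofReal)).map Complex.re).PosDef := by
    have hload : (diagonal (Sum.elim (0 : Fin NI → ℝ) dR)).PosSemidef :=
      PosSemidef.diagonal fun i => by
        cases i with
        | inl i => simp
        | inr i => simpa using (hdR i).le
    convert hblk.add_posSemidef hload using 1
    rw [← fromBlocks_diagonal, fromBlocks_add, fromBlocks_map, ← hYR]
    congr 1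
    · simp
    · simp
    · simp [transpose_map]
  exact ⟨hS.isUnit_of_posDef_map_re (hpos.submatrix (e := Sum.inr) Sum.inr_injective),
    hS.posDef_map_re_schur hYII hpos⟩
end

section
/- Let $A, B \in \mathbb{R}^{n \times n}$ be symmetric with $A$ positive definite, and set $M = A + \mathrm{i} B \in \mathbb{C}^{n \times n}$. Then $M$ is invertible, $\mathrm{Re}(M^{-1})$ is symmetric positive definite, $\mathrm{Im}(M^{-1})$ is symmetric, and $A^{-1} - \mathrm{Re}(M^{-1}) - \mathrm{Im}(M^{-1})\, \mathrm{Re}(M^{-1})^{-1}\, \mathrm{Im}(M^{-1}) = 0$. -/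
open Matrix Complex

/-- For invertible `A` and `S = A + B A⁻¹ B`, a right inverse of `A + iB` is
`S⁻¹ - i A⁻¹ B S⁻¹`. -/
theorem add_I_smul_mul_eq_one {ι : Type*} [Fintype ι] [DecidableEq ι] (A B : Matrix ι ι ℝ)
    (hA : IsUnit A.det) (hS : IsUnit (A + B * A⁻¹ * B).det) :
    (A.map Complex.ofReal + Complex.I • B.map Complex.ofReal) *
      ((A + B * A⁻¹ * B)⁻¹.map Complex.ofReal +
        Complex.I • (-(A⁻¹ * B * (A + B * A⁻¹ * B)⁻¹)).map Complex.ofReal) = 1 := by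
  set S := A + B * A⁻¹ * B with hS_def
  have map_mul (X Y : Matrix ι ι ℝ) :
      X.map Complex.ofReal * Y.map Complex.ofReal = (X * Y).map Complex.ofReal :=
    (Matrix.map_mul (f := Complex.ofRealHom)).symm
  have real_part : A * S⁻¹ + B * (A⁻¹ * B * S⁻¹) = 1 := by
    rw [← Matrix.mul_nonsing_inv S hS]
    nth_rewrite 3 [hS_def]
    noncomm_ring
  have imag_part : B * S⁻¹ + A * -(A⁻¹ * B * S⁻¹) = 0 := by
    rw [Matrix.mul_neg, Matrix.mul_assoc, Matrix.mul_nonsing_inv_cancel_left _ _ hA,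
      add_neg_cancel]
  simp only [Matrix.add_mul, Matrix.mul_add, Matrix.smul_mul, Matrix.mul_smul, map_mul]
  ext i j
  have hr := congrFun (congrFun real_part i) j
  have hi := congrFun (congrFun imag_part i) j
  simp only [Matrix.add_apply, Matrix.mul_neg, Matrix.neg_apply, Matrix.zero_apply] at hr hi
  apply Complex.ext
  all_goals by_cases hij : i = j <;> simp_all [Matrix.one_apply]

/-- For real symmetric `A, B` with `A` positive definite and `M = A + iB`: `M` is invertible,
`Re(M⁻¹)` is symmetric positive definite, `Im(M⁻¹)` is symmetric, and the Schur-complement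
identity `A⁻¹ - Re(M⁻¹) - Im(M⁻¹) Re(M⁻¹)⁻¹ Im(M⁻¹) = 0` holds. -/
theorem stmt_8 {n : ℕ} (A B : Matrix (Fin n) (Fin n) ℝ)
    (hA : A.PosDef) (hB : B.IsSymm)
    (M : Matrix (Fin n) (Fin n) ℂ)
    (hM : M = A.map Complex.ofReal + Complex.I • B.map Complex.ofReal) :
    IsUnit M ∧
    ((M⁻¹).map Complex.re).PosDef ∧
    ((M⁻¹).map Complex.im).IsSymm ∧
    A⁻¹ - (M⁻¹).map Complex.re -
      (M⁻¹).map Complex.im * ((M⁻¹).map Complex.re)⁻¹ * (M⁻¹).map Complex.im = 0 := by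
  have hAdet : IsUnit A.det := (Matrix.isUnit_iff_isUnit_det A).1 hA.isUnit
  have hSpos : (A + B * A⁻¹ * B).PosDef := by
    have h := hA.inv.posSemidef.conjTranspose_mul_mul_same B
    rw [Matrix.conjTranspose_eq_transpose_of_trivial, hB.eq] at h
    exact hA.add_posSemidef h
  have hSdet := (Matrix.isUnit_iff_isUnit_det _).1 hSpos.isUnit
  have hmul := add_I_smul_mul_eq_one A B hAdet hSdet
  rw [← hM] at hmul
  have hinv := Matrix.inv_eq_right_inv hmul
  have hre : (M⁻¹).map Complex.re = (A + B * A⁻¹ * B)⁻¹ := by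
    ext i j
    simp [hinv]
  have him : (M⁻¹).map Complex.im = -(A⁻¹ * B * (A + B * A⁻¹ * B)⁻¹) := by
    ext i j
    simp [hinv]
  have hMsymm : Mᵀ = M := by
    have hAt : Aᵀ = A := by
      simpa only [Matrix.conjTranspose_eq_transpose_of_trivial] using hA.isHermitian.eq
    rw [hM, Matrix.transpose_add, Matrix.transpose_smul, ← Matrix.transpose_map,
      ← Matrix.transpose_map, hAt, hB.eq]
  refine ⟨IsUnit.of_mul_eq_one _ hmul, hre ▸ hSpos.inv, ?_, ?_⟩
  · rw [Matrix.IsSymm, ← Matrix.transpose_map, Matrix.transpose_nonsing_inv, hMsymm]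
  · rw [hre, him, Matrix.nonsing_inv_nonsing_inv _ hSdet]
    set S := A + B * A⁻¹ * B with hS_def
    have hresolvent : A⁻¹ = S⁻¹ + A⁻¹ * B * (A⁻¹ * B * S⁻¹) := by
      calc
        A⁻¹ = A⁻¹ * (S * S⁻¹) := by rw [Matrix.mul_nonsing_inv S hSdet, Matrix.mul_one]
        _ = A⁻¹ * A * S⁻¹ + A⁻¹ * B * (A⁻¹ * B * S⁻¹) := by
          nth_rewrite 1 [hS_def]
          noncomm_ring
        _ = S⁻¹ + A⁻¹ * B * (A⁻¹ * B * S⁻¹) := by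
          rw [Matrix.nonsing_inv_mul A hAdet, Matrix.one_mul]
    rw [Matrix.neg_mul, Matrix.nonsing_inv_mul_cancel_right _ _ hSdet, Matrix.neg_mul,
      Matrix.mul_neg, neg_neg, sub_sub, ← hresolvent, sub_self]
end

section
/- Let $A, B \in \mathbb{R}^{n \times n}$ be symmetric with $A$ positive definite, and set $M = A + \mathrm{i} B \in \mathbb{C}^{n \times n}$ (which is invertible). Then the real $2n \times 2n$ block matrix $\begin{pmatrix} A^{-1} - \mathrm{Re}(M^{-1}) & \mathrm{Im}(M^{-1}) \\ \mathrm{Im}(M^{-1}) & \mathrm{Re}(M^{-1}) \end{pmatrix}$ is symmetric positive semidefinite. -/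
open Matrix Complex

section

variable {n : Type*} [Fintype n] [DecidableEq n] {A B : Matrix n n ℝ}

theorem Matrix.PosDef.add_mul_inv_mul (hA : A.PosDef) (hB : B.IsHermitian) :
    (A + B * A⁻¹ * B).PosDef := by
  have h := hA.inv.posSemidef.mul_mul_conjTranspose_same B
  rw [hB.eq] at h
  exact hA.add_posSemidef h

/-- The inverse of `A + iB` is `S⁻¹ - i A⁻¹ B S⁻¹`, where `S = A + B A⁻¹ B`. -/
theorem Matrix.PosDef.inv_add_I_smul (hA : A.PosDef) (hB : B.IsHermitian) :
    (A.map Complex.ofReal + Complex.I • B.map Complex.ofReal)⁻¹ =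
      ((A + B * A⁻¹ * B)⁻¹).map Complex.ofReal -
        Complex.I • (A⁻¹ * B * (A + B * A⁻¹ * B)⁻¹).map Complex.ofReal := by
  have hAA : A * A⁻¹ = 1 := mul_nonsing_inv _ ((isUnit_iff_isUnit_det _).mp hA.isUnit)
  have hSS := mul_nonsing_inv _ ((isUnit_iff_isUnit_det _).mp (hA.add_mul_inv_mul hB).isUnit)
  set R := (A + B * A⁻¹ * B)⁻¹
  apply inv_eq_right_inv
  have hmap (X Y : Matrix n n ℝ) :
      X.map Complex.ofReal * Y.map Complex.ofReal = (X * Y).map Complex.ofReal :=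
    (Matrix.map_mul (f := Complex.ofRealHom)).symm
  have hIm : A * (A⁻¹ * B * R) = B * R := by
    rw [← mul_assoc, ← mul_assoc, hAA, one_mul]
  have hRe : A * R + B * (A⁻¹ * B * R) = 1 := by
    rw [← hSS, add_mul]; simp only [mul_assoc]
  rw [add_mul, mul_sub, mul_sub, mul_smul_comm, smul_mul_assoc, smul_mul_assoc, mul_smul_comm,
    smul_smul, Complex.I_mul_I, hmap, hmap, hmap, hmap, hIm]
  calc _ = (A * R).map Complex.ofReal + (B * (A⁻¹ * B * R)).map Complex.ofReal := by
        rw [neg_one_smul]; abel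
    _ = (A * R + B * (A⁻¹ * B * R)).map Complex.ofReal :=
        (Matrix.map_add _ Complex.ofReal_add _ _).symm
    _ = 1 := by rw [hRe, Matrix.map_one _ Complex.ofReal_zero Complex.ofReal_one]

theorem Matrix.PosDef.posSemidef_fromBlocks_schur (hA : A.PosDef) (hB : B.IsHermitian) :
    (Matrix.fromBlocks
      (A⁻¹ - (A + B * A⁻¹ * B)⁻¹) (-(A⁻¹ * B * (A + B * A⁻¹ * B)⁻¹))
      (-(A⁻¹ * B * (A + B * A⁻¹ * B)⁻¹)) (A + B * A⁻¹ * B)⁻¹).PosSemidef := by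
  have hAA : A⁻¹ * A = 1 := nonsing_inv_mul _ ((isUnit_iff_isUnit_det _).mp hA.isUnit)
  have hS := hA.add_mul_inv_mul hB
  have hdet := (isUnit_iff_isUnit_det _).mp hS.isUnit
  have hSR := mul_nonsing_inv _ hdet
  have hRS := nonsing_inv_mul _ hdet
  have hAA' : A * A⁻¹ = 1 := mul_nonsing_inv _ ((isUnit_iff_isUnit_det _).mp hA.isUnit)
  have hcomm : (A + B * A⁻¹ * B) * (A⁻¹ * B) = B * A⁻¹ * (A + B * A⁻¹ * B) := by
    rw [add_mul, mul_add, ← mul_assoc A, hAA', mul_assoc B A⁻¹ A, hAA, one_mul, mul_one]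
    simp only [mul_assoc]
  have hSA : A⁻¹ * (A + B * A⁻¹ * B) = 1 + A⁻¹ * B * A⁻¹ * B := by
    rw [mul_add, hAA]; simp only [mul_assoc]
  have hinv := nonsing_inv_nonsing_inv _ hdet
  have hR := hS.inv
  set S := A + B * A⁻¹ * B
  have hsymm : A⁻¹ * B * S⁻¹ = S⁻¹ * B * A⁻¹ := by
    calc A⁻¹ * B * S⁻¹ = S⁻¹ * (S * (A⁻¹ * B)) * S⁻¹ := by
          rw [← mul_assoc S⁻¹, hRS, one_mul]
      _ = S⁻¹ * B * A⁻¹ * (S * S⁻¹) := by rw [hcomm]; simp only [mul_assoc]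
      _ = S⁻¹ * B * A⁻¹ := by rw [hSR, mul_one]
  have hherm : (-(A⁻¹ * B * S⁻¹))ᴴ = -(A⁻¹ * B * S⁻¹) := by
    rw [conjTranspose_neg, conjTranspose_mul, conjTranspose_mul, hA.inv.isHermitian.eq, hB.eq,
      hR.isHermitian.eq, hsymm, mul_assoc]
  have hschur : A⁻¹ - S⁻¹ - -(A⁻¹ * B * S⁻¹) * S * -(A⁻¹ * B * S⁻¹) = 0 := by
    have h : A⁻¹ = S⁻¹ + A⁻¹ * B * A⁻¹ * B * S⁻¹ := by
      calc A⁻¹ = A⁻¹ * S * S⁻¹ := by rw [mul_assoc, hSR, mul_one]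
        _ = _ := by rw [hSA, add_mul, one_mul]
    have h' : -(A⁻¹ * B * S⁻¹) * S * -(A⁻¹ * B * S⁻¹) = A⁻¹ * B * A⁻¹ * B * S⁻¹ := by
      rw [neg_mul, neg_mul_neg, mul_assoc (A⁻¹ * B), hRS, mul_one]; simp only [mul_assoc]
    rw [h', sub_sub, ← h, sub_self]
  have := hR.isUnit.invertible
  have key := PosDef.fromBlocks₂₂ (A⁻¹ - S⁻¹) (-(A⁻¹ * B * S⁻¹)) hR
  rw [hherm, hinv, hschur] at key
  exact key.mpr .zero

end

/-- Equation (37) in Appendix A: for real symmetric `A, B` with `A` positive definite and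
`M = A + iB`, the real block matrix
`[[A⁻¹ - Re(M⁻¹), Im(M⁻¹)], [Im(M⁻¹), Re(M⁻¹)]]` is symmetric positive semidefinite. -/
theorem stmt_9 {n : ℕ} (A B : Matrix (Fin n) (Fin n) ℝ)
    (hA : A.PosDef) (hB : B.IsSymm)
    (M : Matrix (Fin n) (Fin n) ℂ)
    (hM : M = A.map Complex.ofReal + Complex.I • B.map Complex.ofReal) :
    (Matrix.fromBlocks
      (A⁻¹ - (M⁻¹).map Complex.re) ((M⁻¹).map Complex.im)
      ((M⁻¹).map Complex.im) ((M⁻¹).map Complex.re)).PosSemidef := by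
  have hB' : B.IsHermitian := by rw [IsHermitian, conjTranspose_eq_transpose_of_trivial, hB.eq]
  have hre : (M⁻¹).map Complex.re = (A + B * A⁻¹ * B)⁻¹ := by
    rw [hM, hA.inv_add_I_smul hB']; ext; simp
  have him : (M⁻¹).map Complex.im = -(A⁻¹ * B * (A + B * A⁻¹ * B)⁻¹) := by
    rw [hM, hA.inv_add_I_smul hB']; ext; simp
  rw [hre, him]
  exact hA.posSemidef_fromBlocks_schur hB'
end

section
/- Let $X \in \mathbb{R}^{m \times k}$ have full column rank $k$ and let $Y \in \mathbb{R}^{m \times k}$ satisfy $X^T Y = Y^T X$. Then there exists a symmetric matrix $B \in \mathbb{R}^{m \times m}$ such that $B X = Y$. -/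
open Matrix

/-- A matrix of full column rank over a field has a left inverse. -/
theorem Matrix.exists_mul_eq_one_of_rank_eq_card {K m n : Type*} [Field K] [Fintype m]
    [DecidableEq m] [Fintype n] [DecidableEq n] {X : Matrix m n K}
    (h : X.rank = Fintype.card n) : ∃ L : Matrix n m K, L * X = 1 := by
  have hker : LinearMap.ker (Matrix.toLin' X) = ⊥ := by
    have hsum : X.rank + _ = _ := (Matrix.toLin' X).finrank_range_add_finrank_ker
    rw [Module.finrank_fintype_fun_eq_card] at hsum
    exact Submodule.finrank_eq_zero.mp (by omega)
  obtain ⟨g, hg⟩ := (Matrix.toLin' X).exists_leftInverse_of_injective hker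
  refine ⟨LinearMap.toMatrix' g, ?_⟩
  rw [← LinearMap.toMatrix'_id, ← hg, LinearMap.toMatrix'_comp, LinearMap.toMatrix'_toLin']

/-- Symmetric completion: if `X` has full column rank `k` and `Xᵀ Y = Yᵀ X`, then there is a
symmetric matrix `B` with `B X = Y`. -/
theorem stmt_11 {m k : ℕ} (X Y : Matrix (Fin m) (Fin k) ℝ)
    (hrank : X.rank = k) (hsym : Xᵀ * Y = Yᵀ * X) :
    ∃ B : Matrix (Fin m) (Fin m) ℝ, B = Bᵀ ∧ B * X = Y := by
  obtain ⟨L, hL⟩ := Matrix.exists_mul_eq_one_of_rank_eq_card (X := X) (by simpa using hrank)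
  refine ⟨Y * L + Lᵀ * Yᵀ - Lᵀ * (Xᵀ * Y) * L, ?_, ?_⟩
  · have hT : (Xᵀ * Y)ᵀ = Xᵀ * Y := by simp [transpose_mul, hsym]
    rw [transpose_sub, transpose_add, transpose_mul (Lᵀ * (Xᵀ * Y)), transpose_mul Lᵀ (Xᵀ * Y), hT]
    simp only [transpose_mul, transpose_transpose, Matrix.mul_assoc]
    rw [add_comm]
  · rw [Matrix.sub_mul, Matrix.add_mul, Matrix.mul_assoc Y, Matrix.mul_assoc _ L, hL, hsym]
    simp [Matrix.mul_assoc]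
end

section
/- Let $n \geq 2$, $Y_0 > 0$, and let $x, y \in \mathbb{C}^n$ satisfy $\|x\|_2 = \|y\|_2$. Assume the real vectors $\mathrm{Re}(x + y)$ and $\mathrm{Im}(x + y)$ are linearly independent. Then there exists a real symmetric matrix $B \in \mathbb{R}^{n \times n}$ such that $(Y_0 I - \mathrm{i} B) x = (Y_0 I + \mathrm{i} B) y$; equivalently, the unitary matrix $\Theta = (Y_0 I + \mathrm{i} B)^{-1}(Y_0 I - \mathrm{i} B)$ satisfies $\Theta x = y$. -/
open Matrix Complex

section SymmetricInterpolation

variable {ι : Type*} [Fintype ι]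

/-- A pair of linearly independent real vectors `p`, `q` admits a vector `r` with `r ⬝ᵥ p = 1`
and `r ⬝ᵥ q = 0`. -/
theorem exists_dotProduct_eq_one_and_eq_zero {p q : ι → ℝ} (h : LinearIndependent ℝ ![p, q]) :
    ∃ r : ι → ℝ, r ⬝ᵥ p = 1 ∧ r ⬝ᵥ q = 0 := by
  set w : ι → ℝ := (q ⬝ᵥ q) • p - (p ⬝ᵥ q) • q with hw
  have hwq : w ⬝ᵥ q = 0 := by
    simp only [hw, sub_dotProduct, smul_dotProduct, smul_eq_mul]
    ring
  have hwp : w ⬝ᵥ p ≠ 0 := by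
    intro hwp
    have hww : w ⬝ᵥ w = 0 := by
      conv_lhs => rw [hw]
      rw [dotProduct_sub, dotProduct_smul, dotProduct_smul, hwp, hwq]
      simp
    rw [dotProduct_self_eq_zero] at hww
    have hqq : q ⬝ᵥ q = 0 :=
      (LinearIndependent.pair_iff.mp h (q ⬝ᵥ q) (-(p ⬝ᵥ q)) (by
        rw [neg_smul, ← sub_eq_add_neg, ← hw, hww])).1
    have hq : q ≠ 0 := by simpa using h.ne_zero 1
    exact hq (dotProduct_self_eq_zero.mp hqq)
  refine ⟨(w ⬝ᵥ p)⁻¹ • w, ?_, ?_⟩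
  · rw [smul_dotProduct, smul_eq_mul, inv_mul_cancel₀ hwp]
  · rw [smul_dotProduct, hwq, smul_zero]

/-- A symmetric real matrix can be prescribed on two linearly independent vectors, subject only to
the compatibility condition imposed by symmetry. -/
theorem exists_isSymm_mulVec_eq_pair {p q a b : ι → ℝ} (h : LinearIndependent ℝ ![p, q])
    (hab : a ⬝ᵥ q = b ⬝ᵥ p) :
    ∃ B : Matrix ι ι ℝ, B.IsSymm ∧ B *ᵥ p = a ∧ B *ᵥ q = b := by
  obtain ⟨r, hrp, hrq⟩ := exists_dotProduct_eq_one_and_eq_zero h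
  obtain ⟨s, hsq, hsp⟩ := exists_dotProduct_eq_one_and_eq_zero
    (LinearIndependent.pair_symm_iff.mp h)
  refine ⟨vecMulVec a r + vecMulVec r a + vecMulVec b s + vecMulVec s b
    - (a ⬝ᵥ p) • vecMulVec r r - (a ⬝ᵥ q) • (vecMulVec r s + vecMulVec s r)
    - (b ⬝ᵥ q) • vecMulVec s s, ?_, ?_, ?_⟩
  · ext i j
    simp only [transpose_apply, Matrix.sub_apply, Matrix.add_apply, Matrix.smul_apply, vecMulVec_apply,
      smul_eq_mul]
    ring
  · ext i
    simp only [sub_mulVec, add_mulVec, smul_mulVec, vecMulVec_mulVec, hrp, hsp, ← hab,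
      Pi.sub_apply, Pi.add_apply, Pi.smul_apply, MulOpposite.smul_eq_mul_unop,
      MulOpposite.unop_op, smul_eq_mul]
    ring
  · ext i
    simp only [sub_mulVec, add_mulVec, smul_mulVec, vecMulVec_mulVec, hrq, hsq,
      Pi.sub_apply, Pi.add_apply, Pi.smul_apply, MulOpposite.smul_eq_mul_unop,
      MulOpposite.unop_op, smul_eq_mul]
    ring

end SymmetricInterpolation

section RealMatrixOnComplexVector

variable {ι : Type*} [Fintype ι]

theorem map_ofReal_mulVec_re (B : Matrix ι ι ℝ) (z : ι → ℂ) (i : ι) :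
    ((B.map Complex.ofReal *ᵥ z) i).re = (B *ᵥ fun j => (z j).re) i := by
  simp [mulVec, dotProduct]

theorem map_ofReal_mulVec_im (B : Matrix ι ι ℝ) (z : ι → ℂ) (i : ι) :
    ((B.map Complex.ofReal *ᵥ z) i).im = (B *ᵥ fun j => (z j).im) i := by
  simp [mulVec, dotProduct]

/-- For `c ≠ 0` and `B` real symmetric, `c I + i B` is invertible. -/
theorem det_smul_one_add_I_smul_ne_zero [DecidableEq ι] {c : ℝ} (hc : c ≠ 0)
    {B : Matrix ι ι ℝ} (hB : B.IsSymm) :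
    ((c : ℂ) • (1 : Matrix ι ι ℂ) + Complex.I • B.map Complex.ofReal).det ≠ 0 := by
  intro hdet
  obtain ⟨v, hv, hMv⟩ := exists_mulVec_eq_zero_iff.mpr hdet
  set p : ι → ℝ := fun j => (v j).re with hp
  set q : ι → ℝ := fun j => (v j).im with hq
  have hre : c • p = B *ᵥ q := by
    ext i
    have := congrArg Complex.re (congrFun hMv i)
    simp [add_mulVec, smul_mulVec, map_ofReal_mulVec_im] at this
    simp only [Pi.smul_apply, smul_eq_mul, hp, hq]
    linarith
  have him : c • q = -(B *ᵥ p) := by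
    ext i
    have := congrArg Complex.im (congrFun hMv i)
    simp [add_mulVec, smul_mulVec, map_ofReal_mulVec_re] at this
    simp only [Pi.smul_apply, Pi.neg_apply, smul_eq_mul, hp, hq]
    linarith
  have hsymm : p ⬝ᵥ B *ᵥ q = q ⬝ᵥ B *ᵥ p := by
    rw [dotProduct_mulVec, ← mulVec_transpose, hB.eq, dotProduct_comm]
  have hsum : c * (p ⬝ᵥ p + q ⬝ᵥ q) = 0 := by
    have h₁ : c * (p ⬝ᵥ p) = p ⬝ᵥ B *ᵥ q := by rw [← hre, dotProduct_smul, smul_eq_mul]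
    have h₂ : c * (q ⬝ᵥ q) = -(q ⬝ᵥ B *ᵥ p) := by
      rw [← dotProduct_neg, ← him, dotProduct_smul, smul_eq_mul]
    rw [mul_add, h₁, h₂, hsymm, add_neg_cancel]
  have hsum' := (mul_eq_zero.mp hsum).resolve_left hc
  have hpp : 0 ≤ p ⬝ᵥ p := Finset.sum_nonneg fun i _ => mul_self_nonneg (p i)
  have hqq : 0 ≤ q ⬝ᵥ q := Finset.sum_nonneg fun i _ => mul_self_nonneg (q i)
  have hp0 : p = 0 := dotProduct_self_eq_zero.mp (by linarith)
  have hq0 : q = 0 := dotProduct_self_eq_zero.mp (by linarith)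
  exact hv (funext fun i => Complex.ext (congrFun hp0 i) (congrFun hq0 i))

end RealMatrixOnComplexVector

/-- Steering capability of a fully-connected lossless reciprocal RIS: if `‖x‖₂ = ‖y‖₂` and
the real vectors `Re(x+y)`, `Im(x+y)` are linearly independent, then there exists a real
symmetric susceptance matrix `B` with `(Y₀ I - iB) x = (Y₀ I + iB) y`, equivalently the
unitary matrix `Θ = (Y₀ I + iB)⁻¹ (Y₀ I - iB)` satisfies `Θ x = y`. -/
theorem stmt_12 {n : ℕ} (hn : 2 ≤ n) (Y0 : ℝ) (hY0 : 0 < Y0)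
    (x y : Fin n → ℂ)
    (hnorm : Real.sqrt (∑ i, Complex.normSq (x i)) = Real.sqrt (∑ i, Complex.normSq (y i)))
    (hli : LinearIndependent ℝ
      ![(fun i => (x i + y i).re : Fin n → ℝ), (fun i => (x i + y i).im : Fin n → ℝ)]) :
    ∃ B : Matrix (Fin n) (Fin n) ℝ, B = Bᵀ ∧
      ((Y0 : ℂ) • (1 : Matrix (Fin n) (Fin n) ℂ)
          - Complex.I • B.map Complex.ofReal).mulVec x =
        ((Y0 : ℂ) • (1 : Matrix (Fin n) (Fin n) ℂ)
          + Complex.I • B.map Complex.ofReal).mulVec y ∧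
      (((Y0 : ℂ) • (1 : Matrix (Fin n) (Fin n) ℂ) + Complex.I • B.map Complex.ofReal)⁻¹ *
        ((Y0 : ℂ) • (1 : Matrix (Fin n) (Fin n) ℂ)
          - Complex.I • B.map Complex.ofReal)).mulVec x = y := by
  have hsq : ∑ i, Complex.normSq (x i) = ∑ i, Complex.normSq (y i) :=
    (Real.sqrt_inj (Finset.sum_nonneg fun i _ => Complex.normSq_nonneg _)
      (Finset.sum_nonneg fun i _ => Complex.normSq_nonneg _)).mp hnorm
  obtain ⟨B, hB, hBp, hBq⟩ := exists_isSymm_mulVec_eq_pair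
    (a := fun i => Y0 * (x i - y i).im) (b := fun i => -(Y0 * (x i - y i).re)) hli (by
      rw [← sub_eq_zero, dotProduct, dotProduct, ← Finset.sum_sub_distrib]
      have : ∑ i, Y0 * (Complex.normSq (x i) - Complex.normSq (y i)) = 0 := by
        rw [← Finset.mul_sum, Finset.sum_sub_distrib, hsq, sub_self, mul_zero]
      rw [← this]
      refine Finset.sum_congr rfl fun i _ => ?_
      simp only [Complex.normSq_apply, Complex.sub_re, Complex.sub_im, Complex.add_re,
        Complex.add_im]
      ring)
  have hBxy : Complex.I • (B.map Complex.ofReal *ᵥ (x + y)) = (Y0 : ℂ) • (x - y) := by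
    ext i
    apply Complex.ext
    · have h := (map_ofReal_mulVec_im B (x + y) i).trans (congrFun hBq i)
      simpa using congrArg Neg.neg h
    · have h := (map_ofReal_mulVec_re B (x + y) i).trans (congrFun hBp i)
      simpa using h
  have hsteer : ((Y0 : ℂ) • (1 : Matrix (Fin n) (Fin n) ℂ)
        - Complex.I • B.map Complex.ofReal).mulVec x =
      ((Y0 : ℂ) • (1 : Matrix (Fin n) (Fin n) ℂ)
        + Complex.I • B.map Complex.ofReal).mulVec y := by
    simp only [sub_mulVec, add_mulVec, smul_mulVec, one_mulVec]
    rw [mulVec_add, smul_add, smul_sub] at hBxy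
    rw [sub_eq_iff_eq_add, add_assoc, add_comm (Complex.I • _), hBxy]
    abel
  refine ⟨B, hB.eq.symm, hsteer, ?_⟩
  rw [← mulVec_mulVec, hsteer, mulVec_mulVec, nonsing_inv_mul _
    (det_smul_one_add_I_smul_ne_zero hY0.ne' hB).isUnit, one_mulVec]
end

section
/- Let $m \geq 1$, $1 \leq r \leq m$, $c \geq 0$, $a \in \mathbb{C}^m$, and $d \in \mathbb{R}^m$ with $d_i \geq 0$ for all $i$ and $d_i = 0$ for all $i > r$. Then for every $u \in \mathbb{C}^m$ with $\|u\|_2 = c$, there exists $u' \in \mathbb{C}^m$ with $\|u'\|_2 = c$ and $u'_i = 0$ for all $i > r$, such that $\sum_{i=1}^m |a_i + d_i u'_i|^2 \geq \sum_{i=1}^m |a_i + d_i u_i|^2$. -/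
open Complex

/-- Aligning the phase of `v` with that of `a` maximizes `‖a + d v‖` over a disc. -/
lemma exists_norm_eq_normSq_add_mul_le (a z : ℂ) {d t : ℝ} (hd : 0 ≤ d) (hz : ‖z‖ ≤ t) :
    ∃ v : ℂ, ‖v‖ = t ∧ normSq (a + (d : ℂ) * z) ≤ normSq (a + (d : ℂ) * v) := by
  have ht : 0 ≤ t := (norm_nonneg z).trans hz
  have hw : ‖exp (arg a * I)‖ = 1 := norm_exp_ofReal_mul_I _
  refine ⟨t * exp (arg a * I), by simp [hw, abs_of_nonneg ht], ?_⟩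
  have hv : a + (d : ℂ) * (t * exp (arg a * I)) =
      ((‖a‖ + d * t : ℝ) : ℂ) * exp (arg a * I) := by
    push_cast
    linear_combination -norm_mul_exp_arg_mul_I a
  have hnorm : ‖a + (d : ℂ) * (t * exp (arg a * I))‖ = ‖a‖ + d * t := by
    rw [hv, norm_mul, hw, mul_one, norm_real, Real.norm_of_nonneg (by positivity)]
  rw [normSq_eq_norm_sq, normSq_eq_norm_sq, hnorm]
  gcongr
  calc ‖a + (d : ℂ) * z‖ ≤ ‖a‖ + ‖(d : ℂ) * z‖ := norm_add_le _ _
    _ = ‖a‖ + d * ‖z‖ := by rw [norm_mul, norm_real, Real.norm_of_nonneg hd]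
    _ ≤ ‖a‖ + d * t := by gcongr

/-- Remark 1 of the paper: if the nonnegative weights `d` vanish beyond the first `r`
coordinates, then any feasible `u` with `‖u‖₂ = c` can be replaced by a `u'` of the same
norm supported on the first `r` coordinates without decreasing `∑ᵢ |aᵢ + dᵢ uᵢ|²`. -/
theorem stmt_16 {m : ℕ} (hm : 1 ≤ m) (r : ℕ) (hr1 : 1 ≤ r) (hrm : r ≤ m)
    (c : ℝ) (hc : 0 ≤ c) (a : Fin m → ℂ) (d : Fin m → ℝ)
    (hd : ∀ i, 0 ≤ d i) (hd0 : ∀ i : Fin m, r ≤ (i : ℕ) → d i = 0) :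
    ∀ u : Fin m → ℂ, Real.sqrt (∑ i, Complex.normSq (u i)) = c →
      ∃ u' : Fin m → ℂ, Real.sqrt (∑ i, Complex.normSq (u' i)) = c ∧
        (∀ i : Fin m, r ≤ (i : ℕ) → u' i = 0) ∧
        ∑ i, Complex.normSq (a i + (d i : ℂ) * u i) ≤
          ∑ i, Complex.normSq (a i + (d i : ℂ) * u' i) := by
  intro u hu
  let i₀ : Fin m := ⟨0, hm⟩
  let w : Fin m → ℂ := fun i => if (i : ℕ) < r then u i else 0
  have hw : ∀ i, normSq (w i) ≤ normSq (u i) := fun i => by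
    by_cases h : (i : ℕ) < r <;> simp [w, h, normSq_nonneg]
  set T : ℝ := ∑ i, normSq (u i) - ∑ i ∈ Finset.univ.erase i₀, normSq (w i) with hT
  have hle : normSq (u i₀) ≤ T := by
    have h₁ := Finset.add_sum_erase Finset.univ (fun i => normSq (u i)) (Finset.mem_univ i₀)
    have h₂ := Finset.sum_le_sum fun i (_ : i ∈ Finset.univ.erase i₀) => hw i
    linarith
  have hT₀ : 0 ≤ T := (normSq_nonneg _).trans hle
  obtain ⟨v, hv, hav⟩ := exists_norm_eq_normSq_add_mul_le (a i₀) (u i₀) (hd i₀)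
    (Real.le_sqrt_of_sq_le (by rwa [← normSq_eq_norm_sq]) : ‖u i₀‖ ≤ √T)
  refine ⟨Function.update w i₀ v, ?_, fun i hi => ?_, Finset.sum_le_sum fun i _ => ?_⟩
  · have hrest : ∑ i ∈ Finset.univ.erase i₀, normSq (Function.update w i₀ v i) =
        ∑ i ∈ Finset.univ.erase i₀, normSq (w i) :=
      Finset.sum_congr rfl fun i hi => by
        rw [Function.update_of_ne (Finset.ne_of_mem_erase hi)]
    rw [← Finset.add_sum_erase Finset.univ _ (Finset.mem_univ i₀), hrest,
      Function.update_self, normSq_eq_norm_sq, hv, Real.sq_sqrt hT₀, hT, sub_add_cancel, hu]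
  · have hne : i ≠ i₀ := by
      rintro rfl
      exact absurd (hr1.trans hi) (by simp [i₀])
    rw [Function.update_of_ne hne]
    simp [w, hi]
  · by_cases h : i = i₀
    · subst h
      simpa using hav
    · rw [Function.update_of_ne h]
      by_cases hi : (i : ℕ) < r
      · simp [w, hi]
      · simp [hd0 i (not_lt.mp hi)]
end
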